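/- (Wirtinger's inequality, W^{1,2} form) Let (V,J,Ω,g) be a linear almost-Kähler structure on ℝ^{2m} and (W,J_N,ω_N,h) one on ℝ^{2n}, and let L : V → W be any real-linear map. Then ⟨L*ω_N ∧ Ω^{m-1}/(m-1)!, vol_g⟩ ≤ |L|²/2, where vol_g = Ω^m/m! is the g-volume form and |L|² is the squared Hilbert–Schmidt norm of L. Equivalently, *(L*ω_N ∧ Ω^{m-1}/(m-1)!) ≤ |L|²/2, with equality when L is complex-linear. -/

import Mathlib

open Module

/-- The wedge product of a `p`-form and a `q`-form on a real vector space,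
in the determinant convention. -/
noncomputable def wedgeForm {V : Type} [AddCommGroup V] [Module ℝ V] {p q : ℕ}
    (α : V [⋀^Fin p]→ₗ[ℝ] ℝ) (β : V [⋀^Fin q]→ₗ[ℝ] ℝ) : V [⋀^Fin (p + q)]→ₗ[ℝ] ℝ :=
  (TensorProduct.lid ℝ ℝ).toLinearMap.compAlternatingMap
    ((α.domCoprod β).domDomCongr finSumFinEquiv)

/-- The `k`-th wedge power of a `2`-form. -/
noncomputable def wpow {V : Type} [AddCommGroup V] [Module ℝ V]
    (ω : V [⋀^Fin 2]→ₗ[ℝ] ℝ) : (k : ℕ) → V [⋀^Fin (2 * k)]→ₗ[ℝ] ℝ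
  | 0 => (AlternatingMap.constOfIsEmpty ℝ V (Fin 0) (1 : ℝ)).domDomCongr
      (finCongr (by omega : (0 : ℕ) = 2 * 0))
  | (k + 1) => (wedgeForm ω (wpow ω k)).domDomCongr
      (finCongr (by omega : 2 + 2 * k = 2 * (k + 1)))

/-- A linear functional, seen as a `1`-form (alternating map on `Fin 1`). -/
noncomputable def oneForm {V : Type} [AddCommGroup V] [Module ℝ V] (ξ : V →ₗ[ℝ] ℝ) :
    V [⋀^Fin 1]→ₗ[ℝ] ℝ :=
  AlternatingMap.ofSubsingleton ℝ V ℝ (0 : Fin 1) ξ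


theorem wedge_formula {V : Type} [AddCommGroup V] [Module ℝ V] {p q : ℕ}
    (α : V [⋀^Fin p]→ₗ[ℝ] ℝ) (β : V [⋀^Fin q]→ₗ[ℝ] ℝ) (v : Fin (p + q) → V) :
    wedgeForm α β v = ((p.factorial : ℝ) * q.factorial)⁻¹ *
      ∑ σ : Equiv.Perm (Fin p ⊕ Fin q), ((Equiv.Perm.sign σ : ℤ) : ℝ) *
        (α (fun i => v (finSumFinEquiv (σ (Sum.inl i)))) *
          β (fun j => v (finSumFinEquiv (σ (Sum.inr j))))) := by
  have h := congrArg (fun f => TensorProduct.lid ℝ ℝ (f (fun i => v (finSumFinEquiv i))))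
    (MultilinearMap.domCoprod_alternization_eq α β)
  simp only [MultilinearMap.alternatization_apply, map_sum, AlternatingMap.smul_apply,
    map_nsmul, Fintype.card_fin] at h
  have h2 : wedgeForm α β v = TensorProduct.lid ℝ ℝ (α.domCoprod β (fun i => v (finSumFinEquiv i))) := rfl
  rw [h2, eq_inv_mul_iff_mul_eq₀ (by positivity)]
  rw [nsmul_eq_mul] at h
  push_cast at h
  rw [← h]
  refine Finset.sum_congr rfl fun σ _ => ?_
  rw [Units.smul_def, map_zsmul, zsmul_eq_mul]
  congr 1

theorem wedge_wedge {V : Type} [AddCommGroup V] [Module ℝ V] {p s q : ℕ}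
    (α : V [⋀^Fin p]→ₗ[ℝ] ℝ) (γ : V [⋀^Fin s]→ₗ[ℝ] ℝ) (β : V [⋀^Fin q]→ₗ[ℝ] ℝ)
    (v : Fin (p + (s + q)) → V) :
    wedgeForm α (wedgeForm γ β) v = ((p.factorial : ℝ) * (s.factorial * q.factorial))⁻¹ *
      ∑ σ : Equiv.Perm (Fin p ⊕ Fin (s + q)), ((Equiv.Perm.sign σ : ℤ) : ℝ) *
        (α (fun i => v (finSumFinEquiv (σ (Sum.inl i)))) *
          (γ (fun j => v (finSumFinEquiv (σ (Sum.inr (finSumFinEquiv (Sum.inl j)))))) *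
          β (fun j => v (finSumFinEquiv (σ (Sum.inr (finSumFinEquiv (Sum.inr j)))))))) := by
  rw [wedge_formula]
  simp_rw [wedge_formula γ β]
  simp_rw [mul_left_comm _ ((s.factorial : ℝ) * q.factorial)⁻¹ _, ← Finset.mul_sum, Finset.mul_sum]
  rw [Finset.sum_comm]
  set X := ∑ σ : Equiv.Perm (Fin p ⊕ Fin (s + q)), ((Equiv.Perm.sign σ : ℤ) : ℝ) *
        (α (fun i => v (finSumFinEquiv (σ (Sum.inl i)))) *
          (γ (fun j => v (finSumFinEquiv (σ (Sum.inr (finSumFinEquiv (Sum.inl j)))))) *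
          β (fun j => v (finSumFinEquiv (σ (Sum.inr (finSumFinEquiv (Sum.inr j)))))))) with hX
  have key : ∀ τ : Equiv.Perm (Fin s ⊕ Fin q),
      ∑ σ : Equiv.Perm (Fin p ⊕ Fin (s + q)), ((Equiv.Perm.sign σ : ℤ) : ℝ) *
        (α (fun i => v (finSumFinEquiv (σ (Sum.inl i)))) *
          (((Equiv.Perm.sign τ : ℤ) : ℝ) *
          (γ (fun j => v (finSumFinEquiv (σ (Sum.inr (finSumFinEquiv (τ (Sum.inl j))))))) *
          β (fun j => v (finSumFinEquiv (σ (Sum.inr (finSumFinEquiv (τ (Sum.inr j)))))))))) = X := by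
    intro τ
    rw [hX]
    refine Fintype.sum_equiv
      (Equiv.mulRight (Equiv.sumCongr (1 : Equiv.Perm (Fin p)) (finSumFinEquiv.permCongr τ))) _ _ ?_
    intro σ
    have hs : Equiv.Perm.sign (σ * Equiv.sumCongr (1 : Equiv.Perm (Fin p)) (finSumFinEquiv.permCongr τ))
        = Equiv.Perm.sign σ * Equiv.Perm.sign τ := by
      rw [Equiv.Perm.sign_mul]
      congr 1
      have := Equiv.Perm.sign_sumCongr (1 : Equiv.Perm (Fin p)) (finSumFinEquiv.permCongr τ)
      rw [Equiv.Perm.sign_permCongr, map_one, one_mul] at this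
      exact this
    simp only [Equiv.coe_mulRight, hs, Equiv.Perm.mul_apply]
    simp only [Equiv.sumCongr_apply, Sum.map_inl, Sum.map_inr, Equiv.Perm.one_apply,
      Equiv.permCongr_apply, Equiv.symm_apply_apply]
    push_cast
    ring
  rw [← Finset.mul_sum, ← hX]
  trans ∑ τ : Equiv.Perm (Fin s ⊕ Fin q), ((p.factorial : ℝ) * (s + q).factorial)⁻¹ *
      (((s.factorial : ℝ) * q.factorial)⁻¹ * X)
  · refine Finset.sum_congr rfl fun τ _ => ?_
    rw [← key τ, Finset.mul_sum, Finset.mul_sum]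
  rw [Finset.sum_const, Finset.card_univ, Fintype.card_perm, Fintype.card_sum, Fintype.card_fin,
    Fintype.card_fin, nsmul_eq_mul]
  have h1 : ((s + q).factorial : ℝ) ≠ 0 := by positivity
  field_simp

theorem wedge_swap {V : Type} [AddCommGroup V] [Module ℝ V] {q r : ℕ}
    (α γ : V [⋀^Fin 2]→ₗ[ℝ] ℝ) (β : V [⋀^Fin q]→ₗ[ℝ] ℝ) (h : 2 + q = r) :
    wedgeForm α ((wedgeForm γ β).domDomCongr (finCongr h)) =
      wedgeForm γ ((wedgeForm α β).domDomCongr (finCongr h)) := by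
  subst h
  ext v
  change wedgeForm α (wedgeForm γ β) v = wedgeForm γ (wedgeForm α β) v
  rw [wedge_wedge, wedge_wedge]
  congr 1
  let e : Fin 2 → Fin 2 ⊕ Fin (2 + q) := fun i => Sum.inr (finSumFinEquiv (Sum.inl i))
  let κ : Equiv.Perm (Fin 2 ⊕ Fin (2 + q)) :=
    Equiv.swap (Sum.inl 0) (e 0) * Equiv.swap (Sum.inl 1) (e 1)
  have he : e 0 ≠ e 1 := by simp [e]
  have hκ : Equiv.Perm.sign κ = 1 := by
    simp only [κ, Equiv.Perm.sign_mul]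
    rw [Equiv.Perm.sign_swap (by simp [e]), Equiv.Perm.sign_swap (by simp [e])]; rfl
  have k1 : ∀ i, κ (Sum.inl i) = e i := by
    intro i
    fin_cases i <;> simp [κ, e, Equiv.swap_apply_def, Fin.ext_iff]
  have k2 : ∀ i, κ (Sum.inr (finSumFinEquiv (Sum.inl i))) = Sum.inl i := by
    intro i
    fin_cases i <;> simp [κ, e, Equiv.swap_apply_def, Fin.ext_iff]
  have k3 : ∀ i, κ (Sum.inr (finSumFinEquiv (Sum.inr i))) =
      Sum.inr (finSumFinEquiv (Sum.inr i)) := by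
    intro i
    have hne : ∀ j, (Sum.inr (finSumFinEquiv (Sum.inr i)) : Fin 2 ⊕ Fin (2 + q)) ≠ e j := by
      intro j h
      have := finSumFinEquiv.injective (Sum.inr.inj h)
      cases this
    simp only [κ, Equiv.Perm.mul_apply]
    rw [Equiv.swap_apply_of_ne_of_ne (by simp) (hne 1),
      Equiv.swap_apply_of_ne_of_ne (by simp) (hne 0)]
  refine Fintype.sum_equiv (Equiv.mulRight κ) _ _ ?_
  intro σ
  simp only [Equiv.coe_mulRight, Equiv.Perm.sign_mul, hκ, Equiv.Perm.mul_apply, k1, k2, k3, e, mul_one]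
  ring

theorem wedge_comp {V : Type} [AddCommGroup V] [Module ℝ V] {p q : ℕ}
    (α : V [⋀^Fin p]→ₗ[ℝ] ℝ) (β : V [⋀^Fin q]→ₗ[ℝ] ℝ) (T : V →ₗ[ℝ] V) :
    (wedgeForm α β).compLinearMap T =
      wedgeForm (α.compLinearMap T) (β.compLinearMap T) := by
  ext v
  rw [AlternatingMap.compLinearMap_apply, wedge_formula, wedge_formula]
  rfl

theorem wpow_succ {V : Type} [AddCommGroup V] [Module ℝ V]
    (ω : V [⋀^Fin 2]→ₗ[ℝ] ℝ) (k : ℕ) : wpow ω (k + 1) = (wedgeForm ω (wpow ω k)).domDomCongr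
      (finCongr (by omega : 2 + 2 * k = 2 * (k + 1))) := rfl

theorem wpow_comp {V : Type} [AddCommGroup V] [Module ℝ V]
    (ω : V [⋀^Fin 2]→ₗ[ℝ] ℝ) (T : V →ₗ[ℝ] V) (k : ℕ) :
    (wpow ω k).compLinearMap T = wpow (ω.compLinearMap T) k := by
  induction k with
  | zero => rfl
  | succ k ih =>
    rw [wpow_succ, wpow_succ, ← ih, ← wedge_comp]
    rfl

theorem wedge_smul_right {V : Type} [AddCommGroup V] [Module ℝ V] {p q : ℕ}
    (α : V [⋀^Fin p]→ₗ[ℝ] ℝ) (β : V [⋀^Fin q]→ₗ[ℝ] ℝ) (c : ℝ) (v) :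
    wedgeForm α (c • β) v = c * wedgeForm α β v := by
  rw [wedge_formula, wedge_formula]
  simp only [AlternatingMap.smul_apply, smul_eq_mul, Finset.mul_sum]
  refine Finset.sum_congr rfl fun σ _ => ?_
  ring

theorem wedge_smul_left {V : Type} [AddCommGroup V] [Module ℝ V] {p q : ℕ}
    (α : V [⋀^Fin p]→ₗ[ℝ] ℝ) (β : V [⋀^Fin q]→ₗ[ℝ] ℝ) (c : ℝ) (v) :
    wedgeForm (c • α) β v = c * wedgeForm α β v := by
  rw [wedge_formula, wedge_formula]
  simp only [AlternatingMap.smul_apply, smul_eq_mul, Finset.mul_sum]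
  refine Finset.sum_congr rfl fun σ _ => ?_
  ring

theorem wedge_deriv {V : Type} [AddCommGroup V] [Module ℝ V] {p q : ℕ}
    (α : ℝ → V [⋀^Fin p]→ₗ[ℝ] ℝ) (β : ℝ → V [⋀^Fin q]→ₗ[ℝ] ℝ)
    (α' : V [⋀^Fin p]→ₗ[ℝ] ℝ) (β' : V [⋀^Fin q]→ₗ[ℝ] ℝ)
    (hα : ∀ x, HasDerivAt (fun t => α t x) (α' x) 0)
    (hβ : ∀ x, HasDerivAt (fun t => β t x) (β' x) 0) (v : Fin (p + q) → V) :
    HasDerivAt (fun t => wedgeForm (α t) (β t) v)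
      (wedgeForm α' (β 0) v + wedgeForm (α 0) β' v) 0 := by
  simp_rw [wedge_formula]
  rw [← mul_add, ← Finset.sum_add_distrib]
  refine HasDerivAt.const_mul _ ?_
  refine HasDerivAt.fun_sum fun σ _ => ?_
  rw [← mul_add]
  refine HasDerivAt.const_mul _ ?_
  exact (hα _).mul (hβ _)

theorem wpow_deriv {V : Type} [AddCommGroup V] [Module ℝ V]
    (α : ℝ → V [⋀^Fin 2]→ₗ[ℝ] ℝ) (α' : V [⋀^Fin 2]→ₗ[ℝ] ℝ)
    (hα : ∀ x, HasDerivAt (fun t => α t x) (α' x) 0) (k : ℕ) :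
    ∀ v, HasDerivAt (fun t => wpow (α t) (k + 1) v)
      ((((k : ℝ) + 1) • (wedgeForm α' (wpow (α 0) k)).domDomCongr
        (finCongr (by omega : 2 + 2 * k = 2 * (k + 1)))) v) 0 := by
  induction k with
  | zero =>
    intro v
    have h := wedge_deriv α (fun t => wpow (α t) 0) α' 0 hα
      (fun x => by simpa [wpow] using hasDerivAt_const (0:ℝ) (1:ℝ))
      (fun i => v (finCongr (by omega : 2 + 2 * 0 = 2 * (0 + 1)) i))
    refine h.congr_deriv ?_
    have := wedge_smul_right (α 0) (0 : V [⋀^Fin (2*0)]→ₗ[ℝ] ℝ) 0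
      (fun i => v (finCongr (by omega : 2 + 2 * 0 = 2 * (0 + 1)) i))
    rw [zero_smul, zero_mul] at this
    rw [this]
    simp
  | succ k ih =>
    intro v
    have h := wedge_deriv α (fun t => wpow (α t) (k + 1)) α' _ hα ih
      (fun i => v (finCongr (by omega : 2 + 2 * (k + 1) = 2 * (k + 1 + 1)) i))
    refine h.congr_deriv ?_
    rw [wedge_smul_right, wedge_swap, ← wpow_succ]
    simp only [AlternatingMap.smul_apply, AlternatingMap.domDomCongr_apply, smul_eq_mul]
    push_cast
    simp only [Function.comp_def]
    ring

theorem top_form_comp {V : Type} [AddCommGroup V] [Module ℝ V] {k : ℕ}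
    (b : Basis (Fin k) ℝ V) (f : V [⋀^Fin k]→ₗ[ℝ] ℝ) (T : V →ₗ[ℝ] V) (v : Fin k → V) :
    f (fun i => T (v i)) = LinearMap.det T * f v := by
  rw [f.eq_smul_basis_det b]
  simp only [AlternatingMap.smul_apply, smul_eq_mul]
  have := b.det_comp T v
  simp only [Function.comp_def] at this
  rw [this]; ring

theorem det_deriv {V : Type} [AddCommGroup V] [Module ℝ V] {k : ℕ}
    (b : Basis (Fin k) ℝ V) (A : V →ₗ[ℝ] V) :
    HasDerivAt (fun t : ℝ => LinearMap.det (1 + t • A)) (LinearMap.trace ℝ V A) 0 := by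
  simp_rw [← LinearMap.det_toMatrix b, map_add, map_smul, LinearMap.toMatrix_one,
    LinearMap.trace_eq_matrix_trace ℝ b A]
  rw [funext fun t : ℝ => Matrix.det_one_add_smul t (LinearMap.toMatrix b b A)]
  set P := (Matrix.det (1 + (Polynomial.X : Polynomial ℝ) • (LinearMap.toMatrix b b A).map Polynomial.C)).divX.divX
  set c := (LinearMap.toMatrix b b A).trace
  have h := (((hasDerivAt_id (0:ℝ)).const_mul c).const_add 1).add
    ((P.hasDerivAt 0).mul ((hasDerivAt_id (0:ℝ)).pow 2))
  refine h.congr_deriv ?_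
  simp

/-- A 2-form as a bilinear map. -/
noncomputable def bil {V : Type} [AddCommGroup V] [Module ℝ V]
    (α : V [⋀^Fin 2]→ₗ[ℝ] ℝ) : V →ₗ[ℝ] V →ₗ[ℝ] ℝ :=
  LinearMap.mk₂ ℝ (fun v w => α ![v, w])
    (fun x y z => α.map_vecCons_add ![z] x y)
    (fun c x z => α.map_vecCons_smul ![z] c x)
    (fun z x y => by
      have h := α.map_update_add ![z, x] 1 x y
      have e : ∀ u, Function.update ![z, x] 1 u = ![z, u] := fun u => by
        ext i; fin_cases i <;> rfl
      rwa [e, e, e] at h)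
    (fun c z x => by
      have h := α.map_update_smul ![z, x] 1 c x
      have e : ∀ u, Function.update ![z, x] 1 u = ![z, u] := fun u => by
        ext i; fin_cases i <;> rfl
      rwa [e, e] at h)

theorem bil_apply {V : Type} [AddCommGroup V] [Module ℝ V]
    (α : V [⋀^Fin 2]→ₗ[ℝ] ℝ) (v w : V) : bil α v w = α ![v, w] := rfl

theorem bil_anti {V : Type} [AddCommGroup V] [Module ℝ V]
    (α : V [⋀^Fin 2]→ₗ[ℝ] ℝ) (v w : V) : bil α v w = - bil α w v := by
  have h : ∀ x, bil α x x = 0 := fun x =>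
    α.map_eq_zero_of_eq ![x, x] (i := 0) (j := 1) rfl (by decide)
  have := h (v + w)
  simp only [map_add, LinearMap.add_apply, h] at this
  linarith

theorem form_eta {V : Type} [AddCommGroup V] [Module ℝ V]
    (α : V [⋀^Fin 2]→ₗ[ℝ] ℝ) (x : Fin 2 → V) : α x = bil α (x 0) (x 1) := by
  rw [bil_apply]; congr 1; ext i; fin_cases i <;> rfl

theorem trace_formula {V : Type} [AddCommGroup V] [Module ℝ V] {k : ℕ}
    (J : V →ₗ[ℝ] V) (Ω : V →ₗ[ℝ] V →ₗ[ℝ] ℝ) (b : Basis (Fin k) ℝ V)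
    (hb : ∀ i j, Ω (b i) (J (b j)) = if i = j then 1 else 0) (T : V →ₗ[ℝ] V) :
    LinearMap.trace ℝ V T = ∑ i, Ω (T (b i)) (J (b i)) := by
  rw [LinearMap.trace_eq_matrix_trace ℝ b, Matrix.trace]
  refine Finset.sum_congr rfl fun i _ => ?_
  rw [Matrix.diag_apply, LinearMap.toMatrix_apply]
  have h := congrArg (fun x => Ω x (J (b i))) (b.sum_repr (T (b i)))
  simp only [map_sum, map_smul, LinearMap.sum_apply, LinearMap.smul_apply, hb] at h
  rw [← h]
  simp

theorem exists_op {V : Type} [AddCommGroup V] [Module ℝ V] {k : ℕ}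
    (J : V →ₗ[ℝ] V) (hJ : J ∘ₗ J = -LinearMap.id)
    (Ω : V →ₗ[ℝ] V →ₗ[ℝ] ℝ) (b : Basis (Fin k) ℝ V)
    (hb : ∀ i j, Ω (b i) (J (b j)) = if i = j then 1 else 0) (β : V →ₗ[ℝ] V →ₗ[ℝ] ℝ) :
    ∃ A : V →ₗ[ℝ] V, ∀ v w, Ω (A v) w = β v w := by
  refine ⟨∑ i, (β.flip (J (b i))).smulRight (b i), fun v w => ?_⟩
  have h : Ω ((∑ i, (β.flip (J (b i))).smulRight (b i)) v) ∘ₗ J = β v ∘ₗ J := by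
    refine b.ext fun j => ?_
    simp [hb]
  have h2 : w = J (-(J w)) := by
    have := LinearMap.congr_fun hJ w
    simp at this
    simp [this]
  have h3 := LinearMap.congr_fun h (-(J w))
  rw [LinearMap.comp_apply, LinearMap.comp_apply, ← h2] at h3
  exact h3

theorem wedge_eq_trace {V : Type} [AddCommGroup V] [Module ℝ V] {k : ℕ}
    (J : V →ₗ[ℝ] V) (hJ : J ∘ₗ J = -LinearMap.id)
    (Ω α : V [⋀^Fin 2]→ₗ[ℝ] ℝ)
    (b : Basis (Fin (2 * (k + 1))) ℝ V)
    (hb : ∀ i j, bil Ω (b i) (J (b j)) = if i = j then 1 else 0)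
    (v : Fin (2 * (k + 1)) → V) :
    2 * ((k : ℝ) + 1) * (wedgeForm α (wpow Ω k)).domDomCongr
        (finCongr (by omega : 2 + 2 * k = 2 * (k + 1))) v =
      (∑ i, bil α (b i) (J (b i))) * wpow Ω (k + 1) v := by
  obtain ⟨A, hA⟩ := exists_op J hJ (bil Ω) b hb (bil α)
  have hA2 : ∀ v w, bil Ω v (A w) = bil α v w := fun v w => by
    rw [bil_anti, hA, ← bil_anti]
  have h1 := wpow_deriv (fun t => Ω.compLinearMap (1 + t • A)) ((2 : ℝ) • α) (by
    intro x
    have : (fun t : ℝ => Ω.compLinearMap (1 + t • A) x) = fun t =>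
        Ω x + (2 * α x) * t + bil Ω (A (x 0)) (A (x 1)) * t ^ 2 := by
      funext t
      rw [AlternatingMap.compLinearMap_apply, form_eta, form_eta Ω x, form_eta α x]
      simp [hA, hA2]
      ring
    rw [this]
    have h := (((hasDerivAt_id (0:ℝ)).const_mul (2 * α x)).const_add (Ω x)).add
      (((hasDerivAt_id (0:ℝ)).pow 2).const_mul (bil Ω (A (x 0)) (A (x 1))))
    refine h.congr_deriv ?_
    simp) k v
  have h2 : HasDerivAt (fun t : ℝ => wpow (Ω.compLinearMap (1 + t • A)) (k + 1) v)
      (LinearMap.trace ℝ V A * wpow Ω (k + 1) v) 0 := by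
    have : (fun t : ℝ => wpow (Ω.compLinearMap (1 + t • A)) (k + 1) v) =
        fun t : ℝ => LinearMap.det (1 + t • A) * wpow Ω (k + 1) v := by
      funext t
      rw [← wpow_comp]
      exact top_form_comp b (wpow Ω (k + 1)) (1 + t • A) v
    rw [this]
    exact (det_deriv b A).mul_const _
  have h3 := h1.unique h2
  rw [trace_formula J (bil Ω) b hb] at h3
  simp only [hA] at h3
  rw [← h3]
  have h0 : Ω.compLinearMap (1 + (0:ℝ) • A) = Ω := by
    ext x; simp
  rw [h0]
  simp only [AlternatingMap.smul_apply, AlternatingMap.domDomCongr_apply, smul_eq_mul]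
  rw [wedge_smul_left]
  ring

theorem energy_J {V : Type} [AddCommGroup V] [Module ℝ V] {k : ℕ}
    (J : V →ₗ[ℝ] V) (hJ : J ∘ₗ J = -LinearMap.id)
    (Ω : V →ₗ[ℝ] V →ₗ[ℝ] ℝ) (b : Basis (Fin k) ℝ V)
    (hc : ∀ v w, Ω (J v) (J w) = Ω v w)
    (hb : ∀ i j, Ω (b i) (J (b j)) = if i = j then 1 else 0) (β : V →ₗ[ℝ] V →ₗ[ℝ] ℝ) :
    ∑ i, β (J (b i)) (J (b i)) = ∑ i, β (b i) (b i) := by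
  have hJJ : ∀ w, J (J w) = -w := fun w => by simpa using LinearMap.congr_fun hJ w
  obtain ⟨A, hA⟩ := exists_op J hJ Ω b hb (-(β.compl₂ J))
  have h1 := trace_formula J Ω b hb A
  have h2 := trace_formula J Ω b hb (J * (A * J))
  have h3 : LinearMap.trace ℝ V (J * (A * J)) = - LinearMap.trace ℝ V A := by
    rw [LinearMap.trace_mul_comm, mul_assoc]
    have : J * J = -1 := hJ
    rw [this]; simp
  simp only [Module.End.mul_apply, hc, hA] at h1 h2
  simp [hJJ] at h1 h2
  rw [← h1]
  rw [h3] at h2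
  linarith

theorem wirtinger_inequality {m n : ℕ} (hm : 1 ≤ m) {V W : Type}
    [AddCommGroup V] [Module ℝ V] [FiniteDimensional ℝ V]
    [AddCommGroup W] [Module ℝ W] [FiniteDimensional ℝ W]
    (hdimV : Module.finrank ℝ V = 2 * m) (hdimW : Module.finrank ℝ W = 2 * n)
    (J : V →ₗ[ℝ] V) (hJ : J ∘ₗ J = -LinearMap.id)
    (Ω : V [⋀^Fin 2]→ₗ[ℝ] ℝ)
    (hcompat : ∀ v w : V, Ω ![J v, J w] = Ω ![v, w])
    (hpos : ∀ v : V, v ≠ 0 → 0 < Ω ![v, J v])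
    (JN : W →ₗ[ℝ] W) (hJN : JN ∘ₗ JN = -LinearMap.id)
    (ωN : W [⋀^Fin 2]→ₗ[ℝ] ℝ)
    (hcompatN : ∀ v w : W, ωN ![JN v, JN w] = ωN ![v, w])
    (hposN : ∀ w : W, w ≠ 0 → 0 < ωN ![w, JN w])
    (L : V →ₗ[ℝ] W)
    (b : Basis (Fin (2 * m)) ℝ V)
    (hb : ∀ i j, Ω ![b i, J (b j)] = if i = j then 1 else 0)
    (fr : Fin (2 * m) → V)
    (hfr : wpow Ω m fr = (m.factorial : ℝ)) :
    (((m - 1).factorial : ℝ))⁻¹ *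
        (((wedgeForm (ωN.compLinearMap L) (wpow Ω (m - 1))).domDomCongr
          (finCongr (by omega : 2 + 2 * (m - 1) = 2 * m))) fr)
      ≤ (∑ i, ωN ![L (b i), JN (L (b i))]) / 2 ∧
    ((∀ v : V, L (J v) = JN (L v)) →
      (((m - 1).factorial : ℝ))⁻¹ *
          (((wedgeForm (ωN.compLinearMap L) (wpow Ω (m - 1))).domDomCongr
            (finCongr (by omega : 2 + 2 * (m - 1) = 2 * m))) fr)
        = (∑ i, ωN ![L (b i), JN (L (b i))]) / 2) := by
  obtain ⟨k, rfl⟩ : ∃ k, m = k + 1 := ⟨m - 1, by omega⟩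
  have key := wedge_eq_trace J hJ Ω (ωN.compLinearMap L) b hb fr
  rw [hfr] at key
  have hW : (((k + 1 - 1).factorial : ℝ))⁻¹ *
        (((wedgeForm (ωN.compLinearMap L) (wpow Ω (k + 1 - 1))).domDomCongr
          (finCongr (by omega : 2 + 2 * (k + 1 - 1) = 2 * (k + 1)))) fr) =
      (∑ i, bil (ωN.compLinearMap L) (b i) (J (b i))) / 2 := by
    change ((k.factorial : ℝ))⁻¹ * ((wedgeForm (ωN.compLinearMap L) (wpow Ω k)).domDomCongr
        (finCongr (by omega : 2 + 2 * k = 2 * (k + 1))) fr) = _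
    have hk : (k.factorial : ℝ) ≠ 0 := by positivity
    have hk1 : (k : ℝ) + 1 ≠ 0 := by positivity
    rw [Nat.factorial_succ] at key
    push_cast at key
    rw [inv_mul_eq_iff_eq_mul₀ hk]
    apply mul_left_cancel₀ (mul_ne_zero two_ne_zero hk1)
    rw [key]
    ring
  rw [hW]
  have hbil : ∀ v w, bil (ωN.compLinearMap L) v w = bil ωN (L v) (L w) := fun v w => by
    
    rw [bil_apply, AlternatingMap.compLinearMap_apply, form_eta]; rfl
  have hJJ : ∀ w, JN (JN w) = -w := fun w => by simpa using LinearMap.congr_fun hJN w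
  have hQ : ∀ w, 0 ≤ bil ωN w (JN w) := fun w => by
    by_cases h : w = 0
    · simp [h]
    · exact (hposN w h).le
  have hcN : ∀ v w, bil ωN (JN v) (JN w) = bil ωN v w := hcompatN
  refine ⟨?_, fun hL => ?_⟩
  · have hE := energy_J J hJ (bil Ω) b hcompat hb (((bil ωN).compl₂ JN).compl₁₂ L L)
    simp only [LinearMap.compl₁₂_apply, LinearMap.compl₂_apply] at hE
    have hle : ∀ x y, bil ωN x y ≤ (bil ωN x (JN x) + bil ωN y (JN y)) / 2 := by
      intro x y
      have h := hQ (x + JN y)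
      simp only [map_add, LinearMap.add_apply, hJJ, map_neg, hcN] at h
      rw [bil_anti ωN y x, bil_anti ωN (JN y) y] at h
      linarith
    have hs := Finset.sum_le_sum (s := Finset.univ)
      (fun i _ => hle (L (b i)) (L (J (b i))))
    rw [← Finset.sum_div, Finset.sum_add_distrib, hE] at hs
    simp only [hbil, ← bil_apply]
    linarith
  · simp only [hbil, hL, bil_apply]
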